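/- Let 0 < r₀ < R, let Ω = {x ∈ ℝ² : r₀ < |x| < R}, let M > 0, λ > 0, and 0 < μ₁ < … < μₙ < M. Then for every integer m ≥ 2 there exists a bounded measurable function φ : Ω → ℝ (φ ∈ L^∞(Ω)) such that there exist at least n·m pairwise distinct functions u : ℝ² → ℝ, each continuous on closure(Ω) and continuously differentiable on Ω, satisfying u = 0 on {x : |x| = R}, u = M on {x : |x| = r₀}, and, at every x ∈ Ω with u(x) ∉ {μ₁,…,μₙ}, u is twice differentiable at x with Δu(x) = λ·φ(x)·#{i : μᵢ < u(x)}. -/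

import Mathlib

/-- The Laplacian of `u : ℝ² → ℝ` at `x`, as the trace of the second derivative. -/
noncomputable def lap (u : EuclideanSpace ℝ (Fin 2) → ℝ)
    (x : EuclideanSpace ℝ (Fin 2)) : ℝ :=
  ∑ i : Fin 2, fderiv ℝ (fderiv ℝ u) x (EuclideanSpace.single i 1) (EuclideanSpace.single i 1)

/-- The planar annulus `{x : r₀ < |x| < R}`. -/
def annulus (r₀ R : ℝ) : Set (EuclideanSpace ℝ (Fin 2)) :=
  {x | r₀ < ‖x‖ ∧ ‖x‖ < R}

open Topology Filter

theorem hasFDerivAt_const_mul_log_norm_sub {E : Type*} [NormedAddCommGroup E]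
    [InnerProductSpace ℝ E] (α β : ℝ) {x : E} (hx : x ≠ 0) :
    HasFDerivAt (fun y : E => α * Real.log ‖y‖ - β) ((α * (‖x‖ ^ 2)⁻¹) • innerSL ℝ x) x := by
  have h2 : ‖x‖ ^ 2 ≠ 0 := by simpa using hx
  have h := (((hasStrictFDerivAt_norm_sq x).hasFDerivAt.log h2).const_mul (α / 2)).sub_const β
  have hfun : (fun y : E => α / 2 * Real.log (‖y‖ ^ 2) - β) =
      fun y => α * Real.log ‖y‖ - β := by
    ext y
    rw [Real.log_pow]
    push_cast
    ring
  have hder : (α / 2) • (‖x‖ ^ 2)⁻¹ • 2 • innerSL ℝ x = (α * (‖x‖ ^ 2)⁻¹) • innerSL ℝ x := by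
    ext v
    simp
    ring
  rwa [hfun, hder] at h

/-- The Laplacian of a radial function, in logarithmic polar coordinates. -/
theorem lap_comp_log_norm {F F' : ℝ → ℝ} {F'' α β : ℝ} {x : EuclideanSpace ℝ (Fin 2)}
    (hx : x ≠ 0)
    (hF : ∀ᶠ t in 𝓝 (α * Real.log ‖x‖ - β), HasDerivAt F (F' t) t)
    (hF' : HasDerivAt F' F'' (α * Real.log ‖x‖ - β)) :
    DifferentiableAt ℝ (fderiv ℝ fun y => F (α * Real.log ‖y‖ - β)) x ∧
      lap (fun y => F (α * Real.log ‖y‖ - β)) x = α ^ 2 * F'' / ‖x‖ ^ 2 := by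
  have h2 : ‖x‖ ^ 2 ≠ 0 := by simpa using hx
  have hs := hasFDerivAt_const_mul_log_norm_sub α β hx
  have hev : (fderiv ℝ fun y => F (α * Real.log ‖y‖ - β)) =ᶠ[𝓝 x]
      fun y => (F' (α * Real.log ‖y‖ - β) * (α * (‖y‖ ^ 2)⁻¹)) • innerSL ℝ y := by
    filter_upwards [hs.continuousAt.eventually hF, isOpen_ne.mem_nhds hx] with y hy hy0
    have := (hy.comp_hasFDerivAt y (hasFDerivAt_const_mul_log_norm_sub α β hy0)).fderiv
    rw [smul_smul] at this
    exact this
  have hinv := ((hasDerivAt_inv h2).comp_hasFDerivAt x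
    (hasStrictFDerivAt_norm_sq x).hasFDerivAt).const_mul α
  have hL : HasFDerivAt (fun y => innerSL ℝ y)
      (innerSL ℝ : EuclideanSpace ℝ (Fin 2) →L[ℝ] EuclideanSpace ℝ (Fin 2) →L[ℝ] ℝ) x :=
    ContinuousLinearMap.hasFDerivAt
      (innerSL ℝ : EuclideanSpace ℝ (Fin 2) →L[ℝ] EuclideanSpace ℝ (Fin 2) →L[ℝ] ℝ)
  have hG := (((hF'.comp_hasFDerivAt x hs).mul hinv).smul hL).congr_of_eventuallyEq hev
  refine ⟨hG.differentiableAt, ?_⟩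
  have hn : ‖x‖ ^ 2 = x 0 ^ 2 + x 1 ^ 2 := by
    rw [EuclideanSpace.norm_sq_eq]
    simp
  have hinner (v w : EuclideanSpace ℝ (Fin 2)) :
      (innerSL ℝ : EuclideanSpace ℝ (Fin 2) →L[ℝ] EuclideanSpace ℝ (Fin 2) →L[ℝ] ℝ) v w =
        inner ℝ v w := rfl
  rw [lap, hG.fderiv, Fin.sum_univ_two]
  simp [EuclideanSpace.inner_single_right, hinner]
  rw [hn] at h2 ⊢
  field_simp
  ring

/-- Two nonnegative `C¹` functions vanishing at a common point can be glued there. -/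
theorem contDiff_one_ite_of_nonneg {f g : ℝ → ℝ} {p : ℝ} (hf : ContDiff ℝ 1 f)
    (hg : ContDiff ℝ 1 g) (hf0 : ∀ t, 0 ≤ f t) (hg0 : ∀ t, 0 ≤ g t) (hfp : f p = 0)
    (hgp : g p = 0) : ContDiff ℝ 1 fun t => if t ≤ p then f t else g t := by
  have hf' : deriv f p = 0 :=
    IsLocalMin.deriv_eq_zero (Eventually.of_forall fun t => by rw [hfp]; exact hf0 t)
  have hg' : deriv g p = 0 :=
    IsLocalMin.deriv_eq_zero (Eventually.of_forall fun t => by rw [hgp]; exact hg0 t)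
  have hfd := (hf.differentiable one_ne_zero)
  have hgd := (hg.differentiable one_ne_zero)
  have key : ∀ t, HasDerivAt (fun t => if t ≤ p then f t else g t)
      (if t ≤ p then deriv f t else deriv g t) t := by
    intro t
    rcases lt_trichotomy t p with h | rfl | h
    · rw [if_pos h.le]
      refine (hfd t).hasDerivAt.congr_of_eventuallyEq ?_
      filter_upwards [Iio_mem_nhds h] with s hs
      exact if_pos (le_of_lt hs)
    · rw [if_pos le_rfl, ← hasDerivWithinAt_univ, ← Set.Iic_union_Ici (a := t)]
      refine HasDerivWithinAt.union ?_ ?_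
      · exact (hfd t).hasDerivAt.hasDerivWithinAt.congr (fun s hs => if_pos hs) (if_pos le_rfl)
      · rw [hf', ← hg']
        refine (hgd t).hasDerivAt.hasDerivWithinAt.congr (fun s hs => ?_) ?_
        · rcases (Set.mem_Ici.1 hs).eq_or_lt with rfl | h
          · rw [if_pos le_rfl, hfp, hgp]
          · exact if_neg h.not_ge
        · rw [if_pos le_rfl, hfp, hgp]
    · rw [if_neg h.not_ge]
      refine (hgd t).hasDerivAt.congr_of_eventuallyEq ?_
      filter_upwards [Ioi_mem_nhds h] with s hs
      exact if_neg (not_le.2 hs)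
  rw [contDiff_one_iff_deriv]
  refine ⟨fun t => (key t).differentiableAt, ?_⟩
  rw [funext fun t => (key t).deriv]
  refine (hf.continuous_deriv le_rfl).if_le (hg.continuous_deriv le_rfl) continuous_id
    continuous_const fun t ht => ?_
  rw [ht, hf', hg']

/-- `cos² t` up to `t = π N`, continued by `1`. -/
noncomputable def cosSqCap (N : ℕ) (t : ℝ) : ℝ :=
  1 - if t ≤ N * Real.pi then Real.sin t ^ 2 else 0

theorem cosSqCap_of_le {N : ℕ} {t : ℝ} (h : t ≤ N * Real.pi) :
    cosSqCap N t = Real.cos t ^ 2 := by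
  rw [cosSqCap, if_pos h, Real.cos_sq']

theorem cosSqCap_of_lt {N : ℕ} {t : ℝ} (h : N * Real.pi < t) : cosSqCap N t = 1 := by
  rw [cosSqCap, if_neg h.not_ge, sub_zero]

theorem cosSqCap_nonneg (N : ℕ) (t : ℝ) : 0 ≤ cosSqCap N t := by
  rcases le_or_gt t (N * Real.pi) with h | h
  · rw [cosSqCap_of_le h]
    positivity
  · rw [cosSqCap_of_lt h]
    exact zero_le_one

theorem contDiff_cosSqCap (N : ℕ) : ContDiff ℝ 1 (cosSqCap N) :=
  contDiff_const.sub <| contDiff_one_ite_of_nonneg (Real.contDiff_sin.pow 2) contDiff_const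
    (fun _ => sq_nonneg _) (fun _ => le_rfl) (by simp [Real.sin_nat_mul_pi]) rfl

/-- `cosSqCap` with its first `k` bumps after `π / 2` replaced by zero. -/
noncomputable def bumpProfile (N k : ℕ) (t : ℝ) : ℝ :=
  if t ≤ Real.pi / 2 then cosSqCap N t
  else if t ≤ Real.pi / 2 + k * Real.pi then 0 else cosSqCap N t

theorem pi_div_two_add_lt {N k : ℕ} (hk : k < N) :
    Real.pi / 2 + k * Real.pi < N * Real.pi := by
  have h : (k : ℝ) + 1 ≤ N := by exact_mod_cast hk
  nlinarith [Real.pi_pos]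

theorem cosSqCap_pi_div_two_add {N k : ℕ} (hk : k < N) :
    cosSqCap N (Real.pi / 2 + k * Real.pi) = 0 := by
  rw [cosSqCap_of_le (pi_div_two_add_lt hk).le]
  simp [Real.cos_add, Real.sin_nat_mul_pi]

theorem cosSqCap_pi_div_two {N : ℕ} (hN : 0 < N) : cosSqCap N (Real.pi / 2) = 0 := by
  simpa using cosSqCap_pi_div_two_add hN

theorem contDiff_bumpProfile {N k : ℕ} (hk : k < N) : ContDiff ℝ 1 (bumpProfile N k) := by
  refine contDiff_one_ite_of_nonneg (contDiff_cosSqCap N)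
    (contDiff_one_ite_of_nonneg contDiff_const (contDiff_cosSqCap N) (fun _ => le_rfl)
      (cosSqCap_nonneg N) rfl (cosSqCap_pi_div_two_add hk))
    (cosSqCap_nonneg N) (fun t => ?_) (cosSqCap_pi_div_two (by omega))
    (if_pos (le_add_of_nonneg_right (by positivity)))
  split_ifs
  exacts [le_rfl, cosSqCap_nonneg N t]

theorem bumpProfile_zero (N k : ℕ) : bumpProfile N k 0 = 1 := by
  have := Real.pi_pos
  rw [bumpProfile, if_pos (by positivity), cosSqCap_of_le (by positivity)]
  simp

theorem bumpProfile_of_lt {N k : ℕ} (hk : k < N) {t : ℝ} (ht : N * Real.pi < t) :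
    bumpProfile N k t = 1 := by
  have h1 := pi_div_two_add_lt hk
  have h2 : 0 ≤ k * Real.pi := by positivity
  rw [bumpProfile, if_neg (by linarith), if_neg (by linarith), cosSqCap_of_lt ht]

theorem bumpProfile_eq_zero {N k : ℕ} {t : ℝ} (h1 : Real.pi / 2 < t)
    (h2 : t ≤ Real.pi / 2 + k * Real.pi) : bumpProfile N k t = 0 := by
  rw [bumpProfile, if_neg h1.not_ge, if_pos h2]

theorem bumpProfile_succ_mul_pi {N k : ℕ} (hk : k + 1 < N) :
    bumpProfile N k ((k + 1) * Real.pi) = 1 := by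
  have h1 : (k : ℝ) + 1 ≤ N := by exact_mod_cast hk.le
  have h2 : 0 ≤ k * Real.pi := by positivity
  have := Real.pi_pos
  rw [bumpProfile, if_neg (by linarith), if_neg (by linarith),
    cosSqCap_of_le (by gcongr)]
  have := Real.cos_nat_mul_pi (k + 1)
  push_cast at this
  rw [this, ← pow_mul, mul_comm, pow_mul]
  simp

/-- Off its zero set, the profile is locally `cos²` to the left of `π N`. -/
theorem bumpProfile_eventuallyEq {N k : ℕ} {t : ℝ} (ht : t < N * Real.pi)
    (h : bumpProfile N k t ≠ 0) :
    bumpProfile N k =ᶠ[𝓝 t] fun s => Real.cos s ^ 2 := by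
  rcases lt_trichotomy t (Real.pi / 2) with h1 | rfl | h1
  · filter_upwards [Iio_mem_nhds h1, Iio_mem_nhds ht] with s hs hs'
    rw [bumpProfile, if_pos (le_of_lt hs), cosSqCap_of_le (le_of_lt hs')]
  · exact absurd (by rw [bumpProfile, if_pos le_rfl, cosSqCap_of_le ht.le]; simp) h
  · rcases le_or_gt t (Real.pi / 2 + k * Real.pi) with h2 | h2
    · exact absurd (bumpProfile_eq_zero h1 h2) h
    · filter_upwards [Ioi_mem_nhds h1, Ioi_mem_nhds h2, Iio_mem_nhds ht] with s hs1 hs2 hs3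
      rw [bumpProfile, if_neg (not_le.2 hs1), if_neg (not_le.2 hs2),
        cosSqCap_of_le (le_of_lt hs3)]

/-- The one-dimensional solutions, with reference level `a` and slope parameter `κ`. -/
noncomputable def radialSol (N : ℕ) (a κ : ℝ) (k : ℕ) (t : ℝ) : ℝ :=
  a + κ * ((N * Real.pi - t) * bumpProfile N k t)

/-- The second derivative of `κ (π N - t) cos² t`. -/
noncomputable def cosSqSecondDeriv (N : ℕ) (κ t : ℝ) : ℝ :=
  κ * (4 * (Real.cos t * Real.sin t)
    + (N * Real.pi - t) * (2 * (Real.sin t ^ 2 - Real.cos t ^ 2)))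

theorem contDiff_radialSol {N k : ℕ} (hk : k < N) (a κ : ℝ) :
    ContDiff ℝ 1 (radialSol N a κ k) :=
  contDiff_const.add (contDiff_const.mul
    ((contDiff_const.sub contDiff_id).mul (contDiff_bumpProfile hk)))

theorem radialSol_derivs_of_lt {N k : ℕ} {a κ t : ℝ} (ht : t < N * Real.pi)
    (h : bumpProfile N k t ≠ 0) :
    ∃ F' : ℝ → ℝ, (∀ᶠ s in 𝓝 t, HasDerivAt (radialSol N a κ k) (F' s) s) ∧
      HasDerivAt F' (cosSqSecondDeriv N κ t) t := by
  have hcos (s : ℝ) : HasDerivAt (fun s => Real.cos s ^ 2) (-(2 * (Real.cos s * Real.sin s))) s := by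
    refine ((Real.hasDerivAt_cos s).pow 2).congr_deriv ?_
    push_cast
    ring
  have hlin (s : ℝ) : HasDerivAt (fun s => N * Real.pi - s) (-1) s :=
    (hasDerivAt_id s).const_sub _
  refine ⟨fun s => κ * (-1 * Real.cos s ^ 2
    + (N * Real.pi - s) * -(2 * (Real.cos s * Real.sin s))), ?_, ?_⟩
  · filter_upwards [(bumpProfile_eventuallyEq ht h).eventuallyEq_nhds] with s hs
    refine ((((hlin s).mul (hcos s)).const_mul κ).const_add a).congr_of_eventuallyEq ?_
    filter_upwards [hs] with r hr
    simp [radialSol, hr]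
  · have := (((hcos t).const_mul (-1)).add ((hlin t).mul
      (((Real.hasDerivAt_cos t).mul (Real.hasDerivAt_sin t)).const_mul 2).neg)).const_mul κ
    refine this.congr_deriv ?_
    simp only [cosSqSecondDeriv, Pi.neg_apply, Pi.mul_apply]
    ring

theorem radialSol_derivs_of_gt {N k : ℕ} {a κ t : ℝ} (hk : k < N) (ht : N * Real.pi < t) :
    (∀ᶠ s in 𝓝 t, HasDerivAt (radialSol N a κ k) (-κ) s) := by
  filter_upwards [Ioi_mem_nhds ht] with s hs
  have h : HasDerivAt (fun s => a + κ * (N * Real.pi - s)) (κ * -1) s :=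
    (((hasDerivAt_id s).const_sub _).const_mul κ).const_add a
  rw [mul_neg_one] at h
  refine h.congr_of_eventuallyEq ?_
  filter_upwards [Ioi_mem_nhds hs] with r hr
  rw [radialSol, bumpProfile_of_lt hk hr, mul_one]

theorem abs_cosSqSecondDeriv_le {N : ℕ} {κ t T : ℝ} (ht : 0 ≤ t) (htT : t ≤ T) :
    |cosSqSecondDeriv N κ t| ≤ |κ| * (4 + (N * Real.pi + T) * 2) := by
  have hs := Real.sin_sq_add_cos_sq t
  have hN : 0 ≤ N * Real.pi := by positivity
  rw [cosSqSecondDeriv, abs_mul]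
  gcongr
  refine (abs_add_le _ _).trans (add_le_add ?_ ?_)
  · rw [abs_le]
    constructor <;>
      nlinarith [sq_nonneg (Real.cos t + Real.sin t), sq_nonneg (Real.cos t - Real.sin t)]
  · rw [abs_mul]
    refine mul_le_mul ?_ ?_ (abs_nonneg _) (by linarith)
    · rw [abs_le]
      constructor <;> linarith
    · rw [abs_le]
      constructor <;> nlinarith [sq_nonneg (Real.cos t), sq_nonneg (Real.sin t)]

/-- The number of levels `μ i` strictly below `y`. -/
noncomputable def levelCount {n : ℕ} (μ : Fin n → ℝ) (y : ℝ) : ℝ :=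
  ((Finset.univ.filter fun i => μ i < y).card : ℝ)

theorem levelCount_mono {n : ℕ} (μ : Fin n → ℝ) : Monotone (levelCount μ) := by
  intro y z h
  unfold levelCount
  gcongr with i

theorem abs_div_levelCount_le {n : ℕ} (μ : Fin n → ℝ) (b y : ℝ) :
    |b / levelCount μ y| ≤ |b| := by
  rw [levelCount, abs_div, Nat.abs_cast]
  rcases Nat.eq_zero_or_pos (Finset.univ.filter fun i => μ i < y).card with h | h
  · simp [h]
  · exact div_le_self (abs_nonneg b) (by exact_mod_cast h)

/-- The weight for which the functions `radialSol N a κ k` all solve the radial problem. -/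
noncomputable def radialWeight {n : ℕ} (μ : Fin n → ℝ) (N : ℕ) (a κ t : ℝ) : ℝ :=
  if t < N * Real.pi then
    cosSqSecondDeriv N κ t / levelCount μ (a + κ * ((N * Real.pi - t) * Real.cos t ^ 2))
  else 0

theorem measurable_radialWeight {n : ℕ} (μ : Fin n → ℝ) (N : ℕ) (a κ : ℝ) :
    Measurable (radialWeight μ N a κ) := by
  refine Measurable.ite measurableSet_Iio (Measurable.div ?_ ?_) measurable_const
  · unfold cosSqSecondDeriv
    fun_prop
  · exact (levelCount_mono μ).measurable.comp (by fun_prop)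

theorem abs_radialWeight_le {n : ℕ} (μ : Fin n → ℝ) {N : ℕ} (a : ℝ) {κ t T : ℝ} (ht : 0 ≤ t)
    (htT : t ≤ T) : |radialWeight μ N a κ t| ≤ |κ| * (4 + (N * Real.pi + T) * 2) := by
  refine le_trans ?_ (abs_cosSqSecondDeriv_le ht htT)
  unfold radialWeight
  split_ifs
  · exact abs_div_levelCount_le _ _ _
  · simp

theorem radialSol_solves {n : ℕ} {μ : Fin n → ℝ} {N k : ℕ} {κ : ℝ} (hk : k < N) (hκ : 0 < κ)
    {i₀ : Fin n} {t : ℝ} (ht : radialSol N (μ i₀) κ k t ≠ μ i₀) :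
    ∃ F' : ℝ → ℝ, (∀ᶠ s in 𝓝 t, HasDerivAt (radialSol N (μ i₀) κ k) (F' s) s) ∧
      HasDerivAt F'
        (radialWeight μ N (μ i₀) κ t * levelCount μ (radialSol N (μ i₀) κ k t)) t := by
  have hne : (N * Real.pi - t) * bumpProfile N k t ≠ 0 := by
    intro h
    simp [radialSol, h] at ht
  rcases lt_or_ge t (N * Real.pi) with h | h
  · have hb := right_ne_zero_of_mul hne
    have hcos : bumpProfile N k t = Real.cos t ^ 2 :=
      (bumpProfile_eventuallyEq h hb).self_of_nhds
    have hpos : 0 < (N * Real.pi - t) * Real.cos t ^ 2 :=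
      mul_pos (sub_pos.2 h) ((sq_nonneg _).lt_of_ne (by rw [← hcos]; exact hb.symm))
    have hc : levelCount μ (μ i₀ + κ * ((N * Real.pi - t) * Real.cos t ^ 2)) ≠ 0 := by
      have : 0 < κ * ((N * Real.pi - t) * Real.cos t ^ 2) := mul_pos hκ hpos
      rw [levelCount, Nat.cast_ne_zero]
      exact Finset.card_ne_zero.2 ⟨i₀, by simpa using this⟩
    rw [radialWeight, if_pos h, radialSol, hcos, div_mul_cancel₀ _ hc]
    exact radialSol_derivs_of_lt h hb
  · have h' : N * Real.pi < t := h.lt_of_ne fun e => by simp [e] at hne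
    refine ⟨_, radialSol_derivs_of_gt hk h', ?_⟩
    rw [radialWeight, if_neg h.not_gt, zero_mul]
    exact hasDerivAt_const _ _

theorem closure_annulus_subset (r₀ R : ℝ) : closure (annulus r₀ R) ⊆ {x | r₀ ≤ ‖x‖} :=
  closure_minimal (fun _ hx => hx.1.le) (isClosed_le continuous_const continuous_norm)

theorem radialSol_ne {N k l : ℕ} {a κ : ℝ} (hκ : 0 < κ) (hkl : k < l) (hl : l < N) :
    radialSol N a κ k ((k + 1) * Real.pi) ≠ radialSol N a κ l ((k + 1) * Real.pi) := by
  have h1 : (k : ℝ) + 1 ≤ l := by exact_mod_cast hkl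
  have h2 : (k : ℝ) + 1 < N := by exact_mod_cast (show k + 1 < N by omega)
  have hpi := Real.pi_pos
  have h3 : 0 ≤ k * Real.pi := by positivity
  rw [radialSol, radialSol, bumpProfile_succ_mul_pi (by omega),
    bumpProfile_eq_zero (by linarith) (by nlinarith)]
  have : 0 < κ * (N * Real.pi - (k + 1) * Real.pi) :=
    mul_pos hκ (sub_pos.2 (mul_lt_mul_of_pos_right h2 hpi))
  simp only [mul_one, mul_zero, add_zero]
  linarith

/-- Theorem 1.3: for every `m ≥ 2` there is a weight `φ ∈ L^∞(Ω)` on the annulus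
`Ω = B_R \ closedBall(0, r₀) ⊂ ℝ²` for which the problem
`Δu = λ φ(x) Σᵢ H(u - μᵢ)`, `u = 0` on `|x| = R`, `u = M` on `|x| = r₀`,
admits at least `n·m` pairwise distinct solutions. -/
theorem stmt6 (r₀ R M lam : ℝ) (hr₀ : 0 < r₀) (hrR : r₀ < R) (hM : 0 < M) (hlam : 0 < lam)
    (n : ℕ) (hn : 0 < n) (μ : Fin n → ℝ) (hμmono : StrictMono μ)
    (hμ0 : ∀ i, 0 < μ i) (hμM : ∀ i, μ i < M)
    (m : ℕ) (hm : 2 ≤ m) :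
    ∃ φ : EuclideanSpace ℝ (Fin 2) → ℝ,
      -- φ ∈ L^∞(Ω): bounded and measurable
      Measurable φ ∧ (∃ C : ℝ, ∀ x ∈ annulus r₀ R, |φ x| ≤ C) ∧
      ∃ us : Fin (n * m) → (EuclideanSpace ℝ (Fin 2) → ℝ),
        -- the solutions are pairwise distinct (as functions on Ω)
        (∀ k l, k ≠ l → ∃ x ∈ annulus r₀ R, us k x ≠ us l x) ∧
        ∀ k : Fin (n * m),
          ContinuousOn (us k) (closure (annulus r₀ R)) ∧
          ContDiffOn ℝ 1 (us k) (annulus r₀ R) ∧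
          (∀ x, ‖x‖ = R → us k x = 0) ∧
          (∀ x, ‖x‖ = r₀ → us k x = M) ∧
          (∀ x ∈ annulus r₀ R, (∀ i, us k x ≠ μ i) →
            DifferentiableAt ℝ (fderiv ℝ (us k)) x ∧
            lap (us k) x
              = lam * φ x * (Finset.univ.filter fun i => μ i < us k x).card) := by
  set N := n * m with hN
  have hN0 : 0 < N := Nat.mul_pos hn (by omega)
  obtain ⟨i₀⟩ : Nonempty (Fin n) := ⟨⟨0, hn⟩⟩
  set a := μ i₀ with ha
  have haM : 0 < M - a := sub_pos.2 (hμM i₀)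
  have hNpi : 0 < N * Real.pi := by positivity
  have hlog : 0 < Real.log R - Real.log r₀ := sub_pos.2 (Real.log_lt_log hr₀ hrR)
  obtain ⟨κ, hκ⟩ : ∃ κ, κ = (M - a) / (N * Real.pi) := ⟨_, rfl⟩
  have hκ0 : 0 < κ := hκ ▸ by positivity
  have hκN : κ * (N * Real.pi) = M - a := by rw [hκ]; field_simp
  obtain ⟨α, hα⟩ : ∃ α, α = M / κ / (Real.log R - Real.log r₀) := ⟨_, rfl⟩
  have hα0 : 0 < α := hα ▸ by positivity
  have hαR : κ * (α * Real.log R - α * Real.log r₀) = M := by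
    rw [← mul_sub, hα]
    field_simp
  set T := α * Real.log R - α * Real.log r₀ with hT
  have hNT : N * Real.pi < T := by
    have : κ * (N * Real.pi) < κ * T := by linarith [hμ0 i₀]
    exact lt_of_mul_lt_mul_left this hκ0.le
  have hT0 : 0 ≤ T := (hNpi.trans hNT).le
  have hne : ∀ x : EuclideanSpace ℝ (Fin 2), r₀ ≤ ‖x‖ → x ≠ 0 := fun x hx =>
    norm_pos_iff.1 (hr₀.trans_le hx)
  have hcd : ∀ k < N, ContDiffOn ℝ 1
      (fun x : EuclideanSpace ℝ (Fin 2) =>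
        radialSol N a κ k (α * Real.log ‖x‖ - α * Real.log r₀)) {x | r₀ ≤ ‖x‖} := by
    intro k hk x hx
    have h0 := hne x hx
    exact ((contDiff_radialSol hk a κ).contDiffAt.comp x
      ((contDiffAt_const.mul ((contDiffAt_norm ℝ h0).log (norm_ne_zero_iff.2 h0))).sub
        contDiffAt_const)).contDiffWithinAt
  have hdist : ∀ k l : ℕ, k < l → l < N → ∃ x ∈ annulus r₀ R,
      radialSol N a κ k (α * Real.log ‖x‖ - α * Real.log r₀) ≠
        radialSol N a κ l (α * Real.log ‖x‖ - α * Real.log r₀) := by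
    intro k l hkl hl
    have hk1 : ((k : ℝ) + 1) * Real.pi < T := by
      have : (k : ℝ) + 1 ≤ N := by exact_mod_cast (show k + 1 ≤ N by omega)
      exact (mul_le_mul_of_nonneg_right this Real.pi_pos.le).trans_lt hNT
    have hk0 : 0 < ((k : ℝ) + 1) * Real.pi := by positivity
    obtain ⟨s, hs⟩ : ∃ s, s = Real.log r₀ + (k + 1) * Real.pi / α := ⟨_, rfl⟩
    have hsα : α * s - α * Real.log r₀ = (k + 1) * Real.pi := by
      rw [hs]
      field_simp
      ring
    have hnorm : ‖EuclideanSpace.single (0 : Fin 2) (Real.exp s)‖ = Real.exp s := by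
      simp
    refine ⟨EuclideanSpace.single 0 (Real.exp s), ⟨?_, ?_⟩, ?_⟩
    · rw [hnorm, ← Real.log_lt_iff_lt_exp hr₀]
      exact lt_of_mul_lt_mul_left (by linarith) hα0.le
    · rw [hnorm, ← Real.lt_log_iff_exp_lt (hr₀.trans hrR)]
      exact lt_of_mul_lt_mul_left (by linarith) hα0.le
    · rw [hnorm, Real.log_exp, hsα]
      exact radialSol_ne hκ0 hkl hl
  refine ⟨fun x => α ^ 2 * radialWeight μ N a κ (α * Real.log ‖x‖ - α * Real.log r₀) /
    (lam * ‖x‖ ^ 2), ?_, ⟨α ^ 2 * (|κ| * (4 + (N * Real.pi + T) * 2)) / (lam * r₀ ^ 2), ?_⟩,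
    fun k x => radialSol N a κ k (α * Real.log ‖x‖ - α * Real.log r₀), ?_,
    fun k => ⟨?_, ?_, ?_, ?_, ?_⟩⟩
  · exact (measurable_const.mul ((measurable_radialWeight μ N a κ).comp (by fun_prop))).div
      (by fun_prop)
  · rintro x ⟨hx1, hx2⟩
    have h1 : α * Real.log r₀ ≤ α * Real.log ‖x‖ := by gcongr
    have h2 : α * Real.log ‖x‖ ≤ α * Real.log R := by
      have := hr₀.trans hx1
      gcongr
    have h3 := abs_radialWeight_le μ (N := N) (κ := κ) a (sub_nonneg.2 h1)
      (sub_le_sub_right h2 (α * Real.log r₀))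
    rw [abs_div, abs_mul, abs_of_pos (pow_pos hα0 2),
      abs_of_pos (mul_pos hlam (pow_pos (hr₀.trans hx1) 2))]
    gcongr
  · intro k l hkl
    rcases lt_or_gt_of_ne (Fin.val_ne_of_ne hkl) with h | h
    · exact hdist k l h l.2
    · obtain ⟨x, hx, hx'⟩ := hdist l k h k.2
      exact ⟨x, hx, hx'.symm⟩
  · exact (hcd k k.2).continuousOn.mono (closure_annulus_subset r₀ R)
  · exact (hcd k k.2).mono fun x hx => hx.1.le
  · intro x hx
    simp only [hx]
    rw [radialSol, bumpProfile_of_lt k.2 hNT]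
    linarith
  · intro x hx
    simp only [hx]
    rw [sub_self, radialSol, bumpProfile_zero]
    linarith
  · rintro x ⟨hx1, -⟩ hx
    have hx0 := hne x hx1.le
    obtain ⟨F', h1, h2⟩ := radialSol_solves k.2 hκ0 (hx i₀)
    obtain ⟨h3, h4⟩ := lap_comp_log_norm hx0 h1 h2
    refine ⟨h3, h4.trans ?_⟩
    have := norm_ne_zero_iff.2 hx0
    simp only [levelCount]
    field_simp
    rfl
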